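/- Fix μ* > 0 and a positive integer L, and consider the thresholding rule that declares a server 'slow' if the total processing time of its last L jobs exceeds T = 2L/μ*. Let Y_1, …, Y_L be the server's i.i.d. exponential service times with rate λ > 0. Then: (i) if λ ≤ μ*/3, the server is declared slow with probability at least 1 − ((2/3)·e^{1/3})^L; and (ii) if λ ≥ μ*, the server is declared slow with probability at most (2/e)^L. In both cases the misclassification probability decays exponentially in L. -/

import Mathlib

open MeasureTheory ProbabilityTheory

lemma lintegral_exp_expMeasure {r t : ℝ} (hr : 0 < r) (ht : t < r) :
    ∫⁻ x, ENNReal.ofReal (Real.exp (t * x)) ∂(expMeasure r) = ENNReal.ofReal (r / (r - t)) := by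
  have hrt : 0 < r - t := sub_pos.2 ht
  have h1 : expMeasure r = volume.withDensity (exponentialPDF r) := rfl
  have hm : ∀ s, Measurable (exponentialPDF s) := fun s =>
    (measurable_exponentialPDFReal s).ennreal_ofReal
  rw [h1, lintegral_withDensity_eq_lintegral_mul _ (hm r) (by fun_prop)]
  have h2 : ∀ x, (exponentialPDF r * fun x => ENNReal.ofReal (Real.exp (t * x))) x
      = ENNReal.ofReal (r / (r - t)) * exponentialPDF (r - t) x := by
    intro x
    simp only [Pi.mul_apply, exponentialPDF_eq]
    rw [← ENNReal.ofReal_mul (by split_ifs <;> positivity),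
      ← ENNReal.ofReal_mul (by positivity)]
    congr 1
    split_ifs
    · rw [mul_assoc, ← Real.exp_add, ← mul_assoc, div_mul_cancel₀ _ hrt.ne']
      congr 2
      ring
    · simp
  simp_rw [h2]
  rw [lintegral_const_mul _ (hm _), lintegral_exponentialPDF_eq_one hrt, mul_one]

lemma integrable_mgf_of_exp {Ω : Type*} [MeasurableSpace Ω] (P : Measure Ω)
    {Y : Ω → ℝ} (hY : Measurable Y) {r t : ℝ} (hr : 0 < r) (ht : t < r)
    (hd : P.map Y = expMeasure r) :
    Integrable (fun ω => Real.exp (t * Y ω)) P ∧ mgf Y P t = r / (r - t) := by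
  have hrt : 0 < r - t := sub_pos.2 ht
  have h : ∫⁻ ω, ENNReal.ofReal (Real.exp (t * Y ω)) ∂P = ENNReal.ofReal (r / (r - t)) := by
    rw [← lintegral_exp_expMeasure hr ht, ← hd, lintegral_map (by fun_prop) hY]
  have hm : AEStronglyMeasurable (fun ω => Real.exp (t * Y ω)) P :=
    Measurable.aestronglyMeasurable (by fun_prop)
  have hn : 0 ≤ᵐ[P] (fun ω => Real.exp (t * Y ω)) :=
    Filter.Eventually.of_forall fun _ => (Real.exp_pos _).le
  refine ⟨⟨hm, ?_⟩, ?_⟩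
  · rw [hasFiniteIntegral_iff_ofReal hn, h]
    exact ENNReal.ofReal_lt_top
  · rw [mgf, integral_eq_lintegral_of_nonneg_ae hn hm, h, ENNReal.toReal_ofReal (by positivity)]

/-- **Correctness of the thresholding rule filtering out slow servers.**
Fix `μ* > 0` and `L ≥ 1`; a server is declared slow if the total processing
time of its last `L` jobs exceeds `T = 2L/μ*`.  The service times
`Y 1, …, Y L` are i.i.d. exponential with rate `λ > 0`.  Then
(i) if `λ ≤ μ*/3` the server is declared slow with probability at least
`1 - ((2/3)·e^(1/3))^L`, and (ii) if `λ ≥ μ*` it is declared slow with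
probability at most `(2/e)^L`. -/
theorem thresholding_rule_correct (μstar : ℝ) (hμstar : 0 < μstar) (L : ℕ) (hL : 0 < L)
    (lam : ℝ) (hlam : 0 < lam)
    {Ω : Type*} [MeasurableSpace Ω] (P : Measure Ω) [IsProbabilityMeasure P]
    (Y : Fin L → Ω → ℝ)
    (hmeas : ∀ k, Measurable (Y k))
    (hindep : iIndepFun Y P)
    (hdist : ∀ k, P.map (Y k) = expMeasure lam) :
    (lam ≤ μstar / 3 →
      ENNReal.ofReal (1 - ((2 / 3) * Real.exp (1 / 3)) ^ L) ≤
        P {ω | 2 * L / μstar < ∑ k, Y k ω}) ∧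
    (μstar ≤ lam →
      P {ω | 2 * L / μstar < ∑ k, Y k ω} ≤ ENNReal.ofReal ((2 / Real.exp 1) ^ L)) := by
  have hmgf : ∀ t, t < lam → Integrable (fun ω => Real.exp (t * (∑ k, Y k) ω)) P ∧
      mgf (∑ k, Y k) P t = (lam / (lam - t)) ^ L := by
    intro t ht
    refine ⟨hindep.integrable_exp_mul_sum hmeas
      (fun k _ => (integrable_mgf_of_exp P (hmeas k) hlam ht (hdist k)).1), ?_⟩
    rw [hindep.mgf_sum hmeas]
    simp [(integrable_mgf_of_exp P (hmeas _) hlam ht (hdist _)).2, div_pow]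
  constructor
  · intro h
    have ht : -(μstar / 6) < lam := by linarith
    have hb := measure_le_le_exp_mul_mgf (μ := P) (X := ∑ k, Y k) (2 * L / μstar)
      (t := -(μstar / 6)) (by linarith) (hmgf _ ht).1
    rw [(hmgf _ ht).2] at hb
    have hb2 : P.real {ω | (∑ k, Y k) ω ≤ 2 * L / μstar}
        ≤ ((2 / 3) * Real.exp (1 / 3)) ^ L := by
      refine hb.trans ?_
      rw [mul_comm (2 / 3 : ℝ), mul_pow, ← Real.exp_nat_mul]
      have e : -(-(μstar / 6)) * (2 * L / μstar) = L * (1 / 3) := by field_simp; norm_num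
      rw [e]
      have hp : 0 < lam - -(μstar / 6) := by linarith
      have hq : lam / (lam - -(μstar / 6)) ≤ 2 / 3 := by
        rw [div_le_iff₀ hp]
        linarith
      exact mul_le_mul_of_nonneg_left (pow_le_pow_left₀ (by positivity) hq L) (Real.exp_pos _).le
    have hms : MeasurableSet {ω | (∑ k, Y k) ω ≤ 2 * L / μstar} := by
      simp only [Finset.sum_apply]
      exact measurableSet_le (Finset.measurable_fun_sum _ fun k _ => hmeas k) measurable_const
    have hc : {ω | 2 * L / μstar < ∑ k, Y k ω} = {ω | (∑ k, Y k) ω ≤ 2 * L / μstar}ᶜ := by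
      ext ω
      simp [Finset.sum_apply]
    rw [hc, ← ofReal_measureReal]
    apply ENNReal.ofReal_le_ofReal
    rw [probReal_compl_eq_one_sub hms]
    linarith
  · intro h
    have ht : μstar / 2 < lam := by linarith
    have hb := measure_ge_le_exp_mul_mgf (μ := P) (X := ∑ k, Y k) (2 * L / μstar)
      (t := μstar / 2) (by linarith) (hmgf _ ht).1
    rw [(hmgf _ ht).2] at hb
    have hb2 : P.real {ω | 2 * L / μstar ≤ (∑ k, Y k) ω} ≤ (2 / Real.exp 1) ^ L := by
      refine hb.trans ?_
      rw [div_eq_mul_inv (2 : ℝ) (Real.exp 1), mul_comm (2 : ℝ) (Real.exp 1)⁻¹, ← Real.exp_neg,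
        mul_pow, ← Real.exp_nat_mul]
      have e : -(μstar / 2) * (2 * L / μstar) = L * (-1) := by field_simp
      rw [e]
      have hp : 0 < lam - μstar / 2 := by linarith
      have hq : lam / (lam - μstar / 2) ≤ 2 := by
        rw [div_le_iff₀ hp]
        linarith
      exact mul_le_mul_of_nonneg_left (pow_le_pow_left₀ (by positivity) hq L) (Real.exp_pos _).le
    rw [← ofReal_measureReal]
    apply ENNReal.ofReal_le_ofReal
    refine (measureReal_mono ?_).trans hb2
    intro ω hω
    simp only [Set.mem_ofPred_eq, Finset.sum_apply] at hω ⊢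
    exact hω.le
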